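/- arXiv:1901.00222 — 3 statements merged into one kernel-verified Lean document; each statement's English description precedes it below -/
import Mathlib

section
/- Let s = s₁s₂ ∈ S_{l+1} be the Weyl group element defined in the context (in whichever of the four cases (i)–(iv) applies). Then s fixes each of the points m+2, m+3, …, m+p+1 of {1, …, l+1}, and s permutes the remaining l′+1 points {1, …, m+1} ∪ {m+p+2, …, l+1} in a single cycle of length l′+1; in particular s has order l′+1 in S_{l+1}. -/
/- Common framework: type A_l root system realized in ℝ^{ℕ} (coordinates 1,…,l+1 used),
   the Weyl group as permutations of ℕ acting by permuting coordinates, and the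
   Weyl group element s = s₁s₂ of Proposition 4.2 (all four parity cases). -/

noncomputable section

namespace DPW

/-- The ambient vector space (only coordinates 1,…,l+1 are used). -/
abbrev V : Type := ℕ → ℝ

/-- Standard basis vector e_i. -/
def evec (i : ℕ) : V := fun j => if j = i then 1 else 0

/-- The root e_i − e_j. -/
def rt (i j : ℕ) : V := evec i - evec j

/-- The root system Δ of type A_l. -/
def Delta (l : ℕ) : Set V :=
  {v | ∃ i j, 1 ≤ i ∧ i ≤ l + 1 ∧ 1 ≤ j ∧ j ≤ l + 1 ∧ i ≠ j ∧ v = rt i j}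

/-- Positive roots Δ₊. -/
def DeltaPos (l : ℕ) : Set V :=
  {v | ∃ i j, 1 ≤ i ∧ i < j ∧ j ≤ l + 1 ∧ v = rt i j}

/-- Negative roots Δ₋ = −Δ₊. -/
def DeltaNeg (l : ℕ) : Set V := {v | -v ∈ DeltaPos l}

/-- Action of a permutation on V : (σ·v)_j = v_{σ⁻¹(j)}. -/
def pact (σ : Equiv.Perm ℕ) (v : V) : V := fun j => v (σ⁻¹ j)

/-- row(e_a − e_b) = a. -/
def rowOf (v : V) : ℕ := sInf {a | v a = 1}

/-- col(e_a − e_b) = b. -/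
def colOf (v : V) : ℕ := sInf {b | v b = (-1 : ℝ)}

/-- Product of the simple reflections s_{α_i} = (i, i+1) for i in a list. -/
def swapProd (idxs : List ℕ) : Equiv.Perm ℕ :=
  (idxs.map (fun i => Equiv.swap i (i + 1))).prod

/-- The Weyl group element s = s₁s₂ (cases (i)–(iv) according to the parities of
    m = ⌊(l′−1)/2⌋ and l′; here p = l − l′ and s_γ = (m+1, m+p+2)). -/
def weylS (l l' : ℕ) : Equiv.Perm ℕ :=
  let m := (l' - 1) / 2
  let p := l - l'
  if m % 2 = 0 then
    if l' % 2 = 1 then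
      -- case (i)
      (swapProd (List.range' 2 (m / 2) 2) * swapProd (List.range' (m + p + 2) (m / 2) 2)) *
        (swapProd (List.range' 1 (m / 2) 2) * Equiv.swap (m + 1) (m + p + 2) *
          swapProd (List.range' (m + p + 3) (m / 2) 2))
    else
      -- case (ii)
      (swapProd (List.range' 2 (m / 2) 2) * swapProd (List.range' (m + p + 2) (m / 2 + 1) 2)) *
        (swapProd (List.range' 1 (m / 2) 2) * Equiv.swap (m + 1) (m + p + 2) *
          swapProd (List.range' (m + p + 3) (m / 2) 2))
  else
    if l' % 2 = 1 then
      -- case (iii)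
      (swapProd (List.range' 1 ((m + 1) / 2) 2) *
          swapProd (List.range' (m + p + 2) ((m + 1) / 2) 2)) *
        (swapProd (List.range' 2 ((m - 1) / 2) 2) * Equiv.swap (m + 1) (m + p + 2) *
          swapProd (List.range' (m + p + 3) ((m - 1) / 2) 2))
    else
      -- case (iv)
      (swapProd (List.range' 1 ((m + 1) / 2) 2) *
          swapProd (List.range' (m + p + 2) ((m + 1) / 2) 2)) *
        (swapProd (List.range' 2 ((m - 1) / 2) 2) * Equiv.swap (m + 1) (m + p + 2) *
          swapProd (List.range' (m + p + 3) ((m + 1) / 2) 2))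

/-- Δ_s = {α ∈ Δ₊ : sα ∈ Δ₋}. -/
def DeltaS (l : ℕ) (s : Equiv.Perm ℕ) : Set V :=
  {v ∈ DeltaPos l | pact s v ∈ DeltaNeg l}

/-- Δ_{s⁻¹} = {α ∈ Δ₊ : s⁻¹α ∈ Δ₋}. -/
def DeltaSinv (l : ℕ) (s : Equiv.Perm ℕ) : Set V :=
  {v ∈ DeltaPos l | pact s⁻¹ v ∈ DeltaNeg l}

/-- (Δ̄_K)₊ = {α ∈ Δ₊ : sα ≠ α}. -/
def DeltaKpos (l : ℕ) (s : Equiv.Perm ℕ) : Set V :=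
  {v ∈ DeltaPos l | pact s v ≠ v}

/-- (Δ̄_K)₋ = −(Δ̄_K)₊. -/
def DeltaKneg (l : ℕ) (s : Equiv.Perm ℕ) : Set V := {v | -v ∈ DeltaKpos l s}

/-- Δ^C = {α ∈ (Δ̄_K)₊ : row(sα) = row(α)}. -/
def DeltaC (l : ℕ) (s : Equiv.Perm ℕ) : Set V :=
  {v ∈ DeltaKpos l s | rowOf (pact s v) = rowOf v}

/-- Δ^R = {α ∈ (Δ̄_K)₊ : col(sα) = col(α)}. -/
def DeltaR (l : ℕ) (s : Equiv.Perm ℕ) : Set V :=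
  {v ∈ DeltaKpos l s | colOf (pact s v) = colOf v}

/-- Δ^O = (Δ̄_K)₊ \ (Δ^C ∪ Δ^R). -/
def DeltaO (l : ℕ) (s : Equiv.Perm ℕ) : Set V :=
  DeltaKpos l s \ (DeltaC l s ∪ DeltaR l s)

/-- Δ₁^O = {α ∈ Δ^O : row(α) ≥ m+p+2}. -/
def DeltaO1 (l : ℕ) (s : Equiv.Perm ℕ) (m p : ℕ) : Set V :=
  {v ∈ DeltaO l s | m + p + 2 ≤ rowOf v}

/-- Δ₂^O = {α ∈ Δ^O : col(α) ≤ m+1}. -/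
def DeltaO2 (l : ℕ) (s : Equiv.Perm ℕ) (m : ℕ) : Set V :=
  {v ∈ DeltaO l s | colOf v ≤ m + 1}

/-- Δ₃^O = Δ^O \ (Δ₁^O ∪ Δ₂^O). -/
def DeltaO3 (l : ℕ) (s : Equiv.Perm ℕ) (m p : ℕ) : Set V :=
  DeltaO l s \ (DeltaO1 l s m p ∪ DeltaO2 l s m)

/-- Δ̄_K^k = {α ∈ (Δ̄_K)₊ : s^{−j}α ∈ (Δ̄_K)₊ for 1 ≤ j ≤ k−1 and s^{−k}α ∈ (Δ̄_K)₋}. -/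
def DeltaKk (l : ℕ) (s : Equiv.Perm ℕ) (k : ℕ) : Set V :=
  {v ∈ DeltaKpos l s |
    (∀ j, 1 ≤ j → j ≤ k - 1 → pact (s⁻¹ ^ j) v ∈ DeltaKpos l s) ∧
      pact (s⁻¹ ^ k) v ∈ DeltaKneg l s}

/-- d(α) = min{k ≥ 1 : s^{−k}α ∈ Δ₋}. -/
def dd (l : ℕ) (s : Equiv.Perm ℕ) (v : V) : ℕ :=
  sInf {k | 1 ≤ k ∧ pact (s⁻¹ ^ k) v ∈ DeltaNeg l}

/-- Δ_Z = {e_i − e_j : m+2 ≤ i, j ≤ m+p+1, i ≠ j}. -/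
def DeltaZ (m p : ℕ) : Set V :=
  {v | ∃ i j, m + 2 ≤ i ∧ i ≤ m + p + 1 ∧ m + 2 ≤ j ∧ j ≤ m + p + 1 ∧ i ≠ j ∧ v = rt i j}

/-- The ⟨s⟩-orbit of a vector. -/
def orbitOf (s : Equiv.Perm ℕ) (v : V) : Set V := {w | ∃ n : ℤ, w = pact (s ^ n) v}

/-- The set P_κ (for κ ∈ Δ̄_K^k). -/
def Pk (l : ℕ) (s : Equiv.Perm ℕ) (k : ℕ) (κ : V) : Set (V × V) :=
  {q | (∃ i, 2 ≤ i ∧ i ≤ k - 1 ∧ q.1 ∈ DeltaKk l s i) ∧ q.2 ∈ DeltaKk l s k ∧ κ = q.1 + q.2}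

/-- The set P′_κ (for κ ∈ Δ̄_K^k). -/
def Pk' (l : ℕ) (s : Equiv.Perm ℕ) (k : ℕ) (κ : V) : Set (V × V) :=
  {q | q.1 ∈ DeltaKk l s k ∧ q.2 ∈ DeltaKk l s k ∧ κ = q.1 + q.2}

/-- The eigenvector v^λ of case (i) (m even, l′ = 2m+1 odd). -/
def vlam (m p : ℕ) (lam : ℂ) : ℕ → ℂ := fun j =>
  if j = 0 then 0
  else if j ≤ m + 1 then
    (if j % 2 = 1 then lam ^ ((4 * m + 5 - j) / 2) else lam ^ (j / 2))
  else if j ≤ m + p + 1 then 0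
  else if j ≤ m + p + m + 2 then
    (if (j - (m + p)) % 2 = 0 then lam ^ ((m + (j - (m + p))) / 2)
     else lam ^ ((3 * m + 5 - (j - (m + p))) / 2))
  else 0


lemma swapProd_range'_two_apply (a n x : ℕ) :
    swapProd (List.range' a n 2) x =
      if a ≤ x ∧ x < a + 2 * n then (if (x - a) % 2 = 0 then x + 1 else x - 1) else x := by
  induction n generalizing a with
  | zero => simp [swapProd]
  | succ n ih =>
    have h : swapProd (List.range' a (n + 1) 2) x =
        Equiv.swap a (a + 1) (swapProd (List.range' (a + 2) n 2) x) := by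
      simp [swapProd, List.range'_succ]
    rw [h, ih, Equiv.swap_apply_def]
    split_ifs <;> omega

/-- A permutation which advances an injective enumeration `c 0, …, c (N - 1)` cyclically and
fixes every other point is transitive on the enumerated points and has order `N`. -/
lemma transitive_and_orderOf_eq_of_cyclic {α : Type*} (s : Equiv.Perm α) (N : ℕ) (hN : 0 < N)
    (c : ℕ → α) (hinj : ∀ t < N, ∀ u < N, c t = c u → t = u)
    (hs : ∀ t < N, s (c t) = c ((t + 1) % N))
    (hfix : ∀ x, (∀ t < N, c t ≠ x) → s x = x) :
    (∀ t < N, ∀ u < N, ∃ n : ℕ, (s ^ n) (c t) = c u) ∧ orderOf s = N := by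
  have hpow : ∀ n : ℕ, ∀ t < N, (s ^ n) (c t) = c ((t + n) % N) := by
    intro n
    induction n with
    | zero => intro t ht; simp [Nat.mod_eq_of_lt ht]
    | succ n ih =>
      intro t ht
      rw [pow_succ', Equiv.Perm.mul_apply, ih t ht, hs _ (Nat.mod_lt _ hN), Nat.mod_add_mod,
        add_assoc]
  refine ⟨fun t ht u hu => ⟨N - t + u, ?_⟩, ?_⟩
  · rw [hpow _ t ht, show t + (N - t + u) = N + u by omega, Nat.add_mod_left,
      Nat.mod_eq_of_lt hu]
  · rw [orderOf_eq_iff hN]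
    constructor
    · ext x
      by_cases hx : ∀ t < N, c t ≠ x
      · rw [Equiv.Perm.pow_apply_eq_self_of_apply_eq_self (hfix x hx), Equiv.Perm.one_apply]
      · push Not at hx
        obtain ⟨t, ht, rfl⟩ := hx
        rw [hpow N t ht, Nat.add_mod_right, Nat.mod_eq_of_lt ht, Equiv.Perm.one_apply]
    · intro d hd hd0 h
      have h0 := hpow d 0 hN
      rw [h, Equiv.Perm.one_apply, zero_add, Nat.mod_eq_of_lt hd] at h0
      exact hd0.ne (hinj 0 hN d hd h0)

/-- The `k`-th (counting from `0`) of the points `{1, …, m+1} ∪ {m+p+2, …}`. -/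
def movedPoint (m p k : ℕ) : ℕ := if k ≤ m then k + 1 else k + 1 + p

/-- The involution of `{0, …, N - 1}` exchanging `k` and `k + 1` for all `k` with `k % 2 = b`. -/
def pathFlip (N b k : ℕ) : ℕ :=
  if k % 2 = b then (if k + 1 < N then k + 1 else k) else k - 1

/-- The even numbers below `N` in increasing order, then the odd ones in decreasing order. -/
def zigzag (N t : ℕ) : ℕ := if 2 * t < N then 2 * t else 2 * (N - t) - 1

lemma zigzag_lt {N t : ℕ} (ht : t < N) : zigzag N t < N := by
  unfold zigzag; split_ifs <;> omega

lemma zigzag_injOn {N t u : ℕ} (ht : t < N) (hu : u < N) (h : zigzag N t = zigzag N u) :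
    t = u := by
  unfold zigzag at h; split_ifs at h <;> omega

lemma exists_zigzag_eq {N k : ℕ} (hk : k < N) : ∃ t < N, zigzag N t = k := by
  rcases Nat.mod_two_eq_zero_or_one k with h | h
  · exact ⟨k / 2, by omega, by unfold zigzag; split_ifs <;> omega⟩
  · exact ⟨N - (k + 1) / 2, by omega, by unfold zigzag; split_ifs <;> omega⟩

lemma pathFlip_one_pathFlip_zero_zigzag {N t : ℕ} (hN : 2 ≤ N) (ht : t < N) :
    pathFlip N 1 (pathFlip N 0 (zigzag N t)) = zigzag N ((t + 1) % N) := by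
  have h : (t + 1) % N = if t + 1 = N then 0 else t + 1 := by
    split_ifs with h
    · rw [h, Nat.mod_self]
    · exact Nat.mod_eq_of_lt (by omega)
  rw [h]
  by_cases h1 : 2 * t < N
  · have hz : zigzag N t = 2 * t := by simp [zigzag, h1]
    have hf : pathFlip N 0 (2 * t) = if 2 * t + 1 < N then 2 * t + 1 else 2 * t := by
      simp [pathFlip]
    rw [hz, hf]
    unfold pathFlip zigzag
    split_ifs <;> omega
  · have hz : zigzag N t = 2 * (N - t) - 1 := by simp [zigzag, h1]
    have hf : pathFlip N 0 (2 * (N - t) - 1) = 2 * (N - t) - 2 := by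
      unfold pathFlip; split_ifs <;> omega
    rw [hz, hf]
    unfold pathFlip zigzag
    split_ifs <;> omega

lemma pathFlip_pathFlip {N b k : ℕ} (hb : b < 2) (hk : k < N) :
    pathFlip N b (pathFlip N b k) = k := by
  unfold pathFlip; split_ifs <;> omega

lemma pathFlip_lt {N b k : ℕ} (hk : k < N) : pathFlip N b k < N := by
  unfold pathFlip; split_ifs <;> omega

/-- `weylS` is a product of the two path involutions transported along `movedPoint`; the
parity of `m` decides the order of the factors. -/
lemma exists_weylS_eq_mul (l l' m p : ℕ) (h5 : 5 ≤ l')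
    (hm : m = (l' - 1) / 2) (hp : p = l - l') :
    ∃ s₁ s₂ : Equiv.Perm ℕ, weylS l l' = s₁ * s₂ ∧
      (∀ k < l' + 1, s₁ (movedPoint m p k) = movedPoint m p (pathFlip (l' + 1) ((m + 1) % 2) k)) ∧
      (∀ k < l' + 1, s₂ (movedPoint m p k) = movedPoint m p (pathFlip (l' + 1) (m % 2) k)) ∧
      (∀ x, (∀ k < l' + 1, movedPoint m p k ≠ x) → s₁ x = x ∧ s₂ x = x) := by
  have hout : ∀ x, (∀ k < l' + 1, movedPoint m p k ≠ x) →
      x = 0 ∨ (m + 2 ≤ x ∧ x ≤ m + p + 1) ∨ l' + p + 2 ≤ x := by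
    intro x hx
    by_contra hcon
    by_cases h : x ≤ m + 1
    · exact hx (x - 1) (by omega) (by unfold movedPoint; split_ifs <;> omega)
    · exact hx (x - 1 - p) (by omega) (by unfold movedPoint; split_ifs <;> omega)
  unfold weylS
  simp only [← hm, ← hp]
  split_ifs with h1 h2 h2
  all_goals
    refine ⟨_, _, rfl, ?_, ?_, ?_⟩
    · intro k hk
      simp only [Equiv.Perm.mul_apply, swapProd_range'_two_apply]
      unfold movedPoint pathFlip
      grind
    · intro k hk
      simp only [Equiv.Perm.mul_apply, swapProd_range'_two_apply, Equiv.swap_apply_def]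
      unfold movedPoint pathFlip
      grind
    · intro x hx
      have := hout x hx
      simp only [Equiv.Perm.mul_apply, swapProd_range'_two_apply, Equiv.swap_apply_def]
      constructor <;> grind

/-- s fixes the points m+2,…,m+p+1, acts transitively (hence as a single
cycle of length l′+1) on the remaining points {1,…,m+1} ∪ {m+p+2,…,l+1}, and has
order l′+1 in S_{l+1}. -/
theorem stmt0 (l l' m p : ℕ) (h5 : 5 ≤ l') (hll : l' ≤ l)
    (hm : m = (l' - 1) / 2) (hp : p = l - l') :
    (∀ i, m + 2 ≤ i → i ≤ m + p + 1 → weylS l l' i = i) ∧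
    (∀ i, ((1 ≤ i ∧ i ≤ m + 1) ∨ (m + p + 2 ≤ i ∧ i ≤ l + 1)) →
      ∀ j, ((1 ≤ j ∧ j ≤ m + 1) ∨ (m + p + 2 ≤ j ∧ j ≤ l + 1)) →
        ∃ n : ℕ, ((weylS l l') ^ n) i = j) ∧
    orderOf (weylS l l') = l' + 1 := by
  obtain ⟨s₁, s₂, hw, hs₁, hs₂, hfix⟩ := exists_weylS_eq_mul l l' m p h5 hm hp
  rw [hw]
  have hmp : ∀ i, ((1 ≤ i ∧ i ≤ m + 1) ∨ (m + p + 2 ≤ i ∧ i ≤ l + 1)) →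
      ∃ t < l' + 1, movedPoint m p (zigzag (l' + 1) t) = i := by
    intro i hi
    have : ∃ k < l' + 1, movedPoint m p k = i := by
      rcases hi with hi | hi
      · exact ⟨i - 1, by omega, by unfold movedPoint; split_ifs <;> omega⟩
      · exact ⟨i - 1 - p, by omega, by unfold movedPoint; split_ifs <;> omega⟩
    obtain ⟨k, hk, rfl⟩ := this
    obtain ⟨t, ht, rfl⟩ := exists_zigzag_eq hk
    exact ⟨t, ht, rfl⟩
  have hinj : ∀ t < l' + 1, ∀ u < l' + 1, movedPoint m p (zigzag (l' + 1) t) =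
      movedPoint m p (zigzag (l' + 1) u) → t = u := by
    intro t ht u hu h
    refine zigzag_injOn ht hu ?_
    unfold movedPoint at h
    split_ifs at h <;> omega
  have hfix' : ∀ x, (∀ t < l' + 1, movedPoint m p (zigzag (l' + 1) t) ≠ x) →
      s₁ x = x ∧ s₂ x = x := by
    intro x hx
    refine hfix x fun k hk => ?_
    obtain ⟨t, ht, rfl⟩ := exists_zigzag_eq hk
    exact hx t ht
  constructor
  · intro i hi hi'
    have := hfix i fun k _ => by unfold movedPoint; split_ifs <;> omega
    rw [Equiv.Perm.mul_apply, this.2, this.1]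
  rcases Nat.mod_two_eq_zero_or_one m with hpar | hpar
  · rw [hpar] at hs₂
    rw [show (m + 1) % 2 = 1 by omega] at hs₁
    obtain ⟨htrans, hord⟩ := transitive_and_orderOf_eq_of_cyclic (s₁ * s₂) (l' + 1) (by omega)
      (fun t => movedPoint m p (zigzag (l' + 1) t)) hinj
      (fun t ht => by
        simp only [Equiv.Perm.mul_apply]
        rw [hs₂ _ (zigzag_lt ht), hs₁ _ (pathFlip_lt (zigzag_lt ht)),
          pathFlip_one_pathFlip_zero_zigzag (by omega) ht])
      (fun x hx => by rw [Equiv.Perm.mul_apply, (hfix' x hx).2, (hfix' x hx).1])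
    refine ⟨fun i hi j hj => ?_, hord⟩
    obtain ⟨t, ht, rfl⟩ := hmp i hi
    obtain ⟨u, hu, rfl⟩ := hmp j hj
    exact htrans t ht u hu
  · rw [hpar] at hs₂
    rw [show (m + 1) % 2 = 0 by omega] at hs₁
    obtain ⟨htrans, hord⟩ := transitive_and_orderOf_eq_of_cyclic (s₁ * s₂)⁻¹ (l' + 1) (by omega)
      (fun t => movedPoint m p (zigzag (l' + 1) t)) hinj
      (fun t ht => by
        have hz := zigzag_lt ht
        rw [Equiv.Perm.inv_eq_iff_eq, ← pathFlip_one_pathFlip_zero_zigzag (by omega) ht,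
          Equiv.Perm.mul_apply, hs₂ _ (pathFlip_lt (pathFlip_lt hz)),
          pathFlip_pathFlip (by omega) (pathFlip_lt hz), hs₁ _ (pathFlip_lt hz),
          pathFlip_pathFlip (by omega) hz])
      (fun x hx => by
        rw [Equiv.Perm.inv_eq_iff_eq, Equiv.Perm.mul_apply, (hfix' x hx).2, (hfix' x hx).1])
    refine ⟨fun i hi j hj => ?_, by rwa [orderOf_inv] at hord⟩
    obtain ⟨t, ht, rfl⟩ := hmp i hi
    obtain ⟨u, hu, rfl⟩ := hmp j hj
    obtain ⟨n, hn⟩ := htrans u hu t ht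
    refine ⟨n, ?_⟩
    rw [inv_pow, Equiv.Perm.inv_eq_iff_eq] at hn
    exact hn.symm
end DPW
end
end

section
/- Assume m is even and l′ is odd (case (i)). Then the set Δ_{s^{−1}} = {α ∈ Δ₊ : s^{−1}α ∈ Δ₋} consists exactly of the following roots: α_1 + α_2; the roots α_{2t} + α_{2t+1} + α_{2t+2} for 1 ≤ t ≤ (m−2)/2; the roots α_m + α_{m+1} + ⋯ + α_{m+q} for 1 ≤ q ≤ p; the root γ′ = α_m + ⋯ + α_{m+p+2}; the roots α_i + α_{i+1} + ⋯ + α_{m+p+2} for m+2 ≤ i ≤ m+p+2; the roots α_{m+p+2t} + α_{m+p+2t+1} + α_{m+p+2t+2} for 1 ≤ t ≤ (m−2)/2; the root α_{m+p+m} + α_{m+p+m+1}; and the simple roots α_2, α_4, …, α_m and α_{m+p+2}, α_{m+p+4}, …, α_{m+p+m}. -/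
/- Common framework: type A_l root system realized in ℝ^{ℕ} (coordinates 1,…,l+1 used),
   the Weyl group as permutations of ℕ acting by permuting coordinates, and the
   Weyl group element s = s₁s₂ of Proposition 4.2 (all four parity cases). -/

noncomputable section

namespace DPW

theorem pact_evec (σ : Equiv.Perm ℕ) (i : ℕ) : pact σ (evec i) = evec (σ i) := by
  funext j
  have h : σ⁻¹ j = i ↔ j = σ i := by rw [Equiv.Perm.inv_eq_iff_eq]
  simp only [pact, evec, h]

theorem pact_rt (σ : Equiv.Perm ℕ) (i j : ℕ) : pact σ (rt i j) = rt (σ i) (σ j) := by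
  rw [rt, rt, ← pact_evec, ← pact_evec]
  rfl

theorem neg_rt (i j : ℕ) : -rt i j = rt j i := neg_sub _ _

theorem rt_injective {i j a b : ℕ} (hij : i ≠ j) (h : rt i j = rt a b) :
    i = a ∧ j = b := by
  have hi := congrFun h i
  have hj := congrFun h j
  simp only [rt, evec, Pi.sub_apply, if_true, hij, hij.symm, if_false] at hi hj
  constructor
  · by_contra hia
    rw [if_neg hia] at hi
    split_ifs at hi <;> norm_num at hi
  · by_contra hjb
    rw [if_neg hjb] at hj
    split_ifs at hj <;> norm_num at hj

theorem rt_mem_DeltaNeg {l i j : ℕ} (hij : i ≠ j) :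
    rt i j ∈ DeltaNeg l ↔ 1 ≤ j ∧ j < i ∧ i ≤ l + 1 := by
  constructor
  · rintro ⟨a, b, ha, hab, hb, h⟩
    rw [neg_rt] at h
    obtain ⟨rfl, rfl⟩ := rt_injective hij.symm h
    exact ⟨ha, hab, hb⟩
  · rintro ⟨hj, hji, hi⟩
    exact ⟨j, i, hj, hji, hi, neg_rt i j⟩

theorem mem_DeltaSinv {l : ℕ} {s : Equiv.Perm ℕ} {v : V} :
    v ∈ DeltaSinv l s ↔ ∃ i j, 1 ≤ i ∧ i < j ∧ j ≤ l + 1 ∧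
      1 ≤ s⁻¹ j ∧ s⁻¹ j < s⁻¹ i ∧ s⁻¹ i ≤ l + 1 ∧ v = rt i j := by
  constructor
  · rintro ⟨⟨i, j, hi, hij, hj, rfl⟩, h⟩
    rw [pact_rt, rt_mem_DeltaNeg (s⁻¹.injective.ne hij.ne)] at h
    exact ⟨i, j, hi, hij, hj, h.1, h.2.1, h.2.2, rfl⟩
  · rintro ⟨i, j, hi, hij, hj, h₁, h₂, h₃, rfl⟩
    refine ⟨⟨i, j, hi, hij, hj, rfl⟩, ?_⟩
    rw [pact_rt, rt_mem_DeltaNeg (s⁻¹.injective.ne hij.ne)]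
    exact ⟨h₁, h₂, h₃⟩

/-- A product of the disjoint adjacent transpositions `(a, a+1), (a+2, a+3), …`. -/
theorem swapProd_range'_apply (a k x : ℕ) :
    swapProd (List.range' a k 2) x =
      if a ≤ x ∧ x < a + 2 * k then (if (x - a) % 2 = 0 then x + 1 else x - 1) else x := by
  induction k generalizing a with
  | zero =>
    simp only [swapProd, List.range'_zero, List.map_nil, List.prod_nil, Equiv.Perm.one_apply]
    split_ifs <;> omega
  | succ k ih =>
    have h : swapProd (List.range' a (k + 1) 2) =
        Equiv.swap a (a + 1) * swapProd (List.range' (a + 2) k 2) := by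
      simp [swapProd, List.range'_succ]
    rw [h, Equiv.Perm.mul_apply, ih, Equiv.swap_apply_def]
    split_ifs <;> omega

/-- The values of `s⁻¹` on `{1, …, 2m+p+2}` for `m` even and `l' = 2m+1`. -/
def weylSInvValue (m p x : ℕ) : ℕ :=
  if x ≤ m + 1 then
    if x = 1 then 2
    else if x % 2 = 1 then x - 2
    else if x = m then m + p + 2
    else x + 2
  else if x ≤ m + p + 1 then x
  else if x = m + p + 3 then m + 1
  else if x = m + p + m + 2 then m + p + m + 1
  else if (x - (m + p)) % 2 = 0 then x + 2
  else x - 2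

theorem weylS_inv_apply {l l' m p x : ℕ} (h5 : 5 ≤ l') (hll : l' ≤ l)
    (hm : m = (l' - 1) / 2) (hp : p = l - l') (hme : m % 2 = 0) (hlo : l' % 2 = 1)
    (hx : 1 ≤ x) (hxl : x ≤ l + 1) :
    (weylS l l')⁻¹ x = weylSInvValue m p x := by
  rw [Equiv.Perm.inv_eq_iff_eq]
  simp only [weylS, ← hm, ← hp, if_pos hme, if_pos hlo]
  have hl : l = 2 * m + 1 + p := by omega
  obtain ⟨y, hy⟩ : ∃ y, weylSInvValue m p x = y := ⟨_, rfl⟩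
  obtain ⟨u, hu⟩ : ∃ u, swapProd (List.range' (m + p + 3) (m / 2) 2) y = u := ⟨_, rfl⟩
  obtain ⟨w, hw⟩ : ∃ w, Equiv.swap (m + 1) (m + p + 2) u = w := ⟨_, rfl⟩
  obtain ⟨z, hz⟩ : ∃ z, swapProd (List.range' 1 (m / 2) 2) w = z := ⟨_, rfl⟩
  obtain ⟨a, ha⟩ : ∃ a, swapProd (List.range' (m + p + 2) (m / 2) 2) z = a := ⟨_, rfl⟩
  simp only [Equiv.Perm.mul_apply, hy, hu, hw, hz, ha]
  rw [swapProd_range'_apply] at hu hz ha ⊢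
  rw [Equiv.swap_apply_def] at hw
  unfold weylSInvValue at hy
  split_ifs at hy <;> split_ifs at hu <;> try omega
  all_goals split_ifs at hw <;> try omega
  all_goals split_ifs at hz <;> try omega
  all_goals split_ifs at ha <;> try omega
  all_goals split_ifs <;> omega

set_option maxHeartbeats 1000000 in
theorem weylSInvValue_inversion_iff {m p i j : ℕ} (hm : 2 ≤ m) (hme : m % 2 = 0)
    (hi : 1 ≤ i) (hij : i < j) (hj : j ≤ 2 * m + p + 2) :
    weylSInvValue m p j < weylSInvValue m p i ↔
      i = 1 ∧ j = 3 ∨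
      i % 2 = 0 ∧ i < m ∧ j = i + 3 ∨
      i = m ∧ m + 2 ≤ j ∧ j ≤ m + p + 1 ∨
      i = m ∧ j = m + p + 3 ∨
      m + 2 ≤ i ∧ i ≤ m + p + 2 ∧ j = m + p + 3 ∨
      m + p + 2 ≤ i ∧ i < m + p + m ∧ (i - (m + p)) % 2 = 0 ∧ j = i + 3 ∨
      i = m + p + m ∧ j = m + p + m + 2 ∨
      i ≤ m ∧ i % 2 = 0 ∧ j = i + 1 ∨
      m + p + 2 ≤ i ∧ i ≤ m + p + m ∧ (i - (m + p)) % 2 = 0 ∧ j = i + 1 := by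
  unfold weylSInvValue
  constructor
  · intro h
    by_cases hji : j = i + 1 <;> split_ifs at h <;> try (exfalso; omega)
    all_goals first
      | (left; omega)
      | (right; left; omega)
      | (right; right; left; omega)
      | (right; right; right; left; omega)
      | (right; right; right; right; left; omega)
      | (right; right; right; right; right; left; omega)
      | (right; right; right; right; right; right; left; omega)
      | (right; right; right; right; right; right; right; left; omega)
      | (right; right; right; right; right; right; right; right; omega)
  · rintro (h | h | h | h | h | h | h | h | h) <;> split_ifs <;> omega

theorem weylSInvValue_mem {m p x : ℕ} (hm : 2 ≤ m) (hme : m % 2 = 0)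
    (hx : 1 ≤ x) (hxl : x ≤ 2 * m + p + 2) :
    1 ≤ weylSInvValue m p x ∧ weylSInvValue m p x ≤ 2 * m + p + 2 := by
  unfold weylSInvValue
  split_ifs <;> omega

/-- explicit description of Δ_{s⁻¹} in case (i) (m even, l′ odd). -/
theorem stmt3 (l l' m p : ℕ) (h5 : 5 ≤ l') (hll : l' ≤ l)
    (hm : m = (l' - 1) / 2) (hp : p = l - l')
    (hme : m % 2 = 0) (hlo : l' % 2 = 1) :
    DeltaSinv l (weylS l l') =
      {v | v = rt 1 3 ∨
        (∃ t, 1 ≤ t ∧ t ≤ (m - 2) / 2 ∧ v = rt (2 * t) (2 * t + 3)) ∨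
        (∃ q, 1 ≤ q ∧ q ≤ p ∧ v = rt m (m + q + 1)) ∨
        v = rt m (m + p + 3) ∨
        (∃ i, m + 2 ≤ i ∧ i ≤ m + p + 2 ∧ v = rt i (m + p + 3)) ∨
        (∃ t, 1 ≤ t ∧ t ≤ (m - 2) / 2 ∧ v = rt (m + p + 2 * t) (m + p + 2 * t + 3)) ∨
        v = rt (m + p + m) (m + p + m + 2) ∨
        (∃ t, 1 ≤ t ∧ t ≤ m / 2 ∧ v = rt (2 * t) (2 * t + 1)) ∨
        (∃ t, 1 ≤ t ∧ t ≤ m / 2 ∧ v = rt (m + p + 2 * t) (m + p + 2 * t + 1))} := by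
  have hm2 : 2 ≤ m := by omega
  have hl : l + 1 = 2 * m + p + 2 := by omega
  have key (v : V) : v ∈ DeltaSinv l (weylS l l') ↔ ∃ i j, 1 ≤ i ∧ i < j ∧
      j ≤ 2 * m + p + 2 ∧ weylSInvValue m p j < weylSInvValue m p i ∧ v = rt i j := by
    rw [mem_DeltaSinv, hl]
    refine exists_congr fun i => exists_congr fun j => and_congr_right fun hi =>
      and_congr_right fun hij => and_congr_right fun hj => ?_
    rw [weylS_inv_apply h5 hll hm hp hme hlo hi (by omega),
      weylS_inv_apply h5 hll hm hp hme hlo (by omega) (hl ▸ hj)]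
    have hfi := weylSInvValue_mem (p := p) hm2 hme hi (by omega)
    have hfj := weylSInvValue_mem (p := p) hm2 hme (by omega) hj
    simp only [hfi.2, hfj.1, true_and]
  ext v
  rw [key, Set.mem_ofPred_eq]
  constructor
  · rintro ⟨i, j, hi, hij, hj, hlt, rfl⟩
    rw [weylSInvValue_inversion_iff hm2 hme hi hij hj] at hlt
    rcases hlt with h | h | h | h | h | h | h | h | h
    · exact Or.inl (by rw [h.1, h.2])
    · exact Or.inr <| Or.inl ⟨i / 2, by omega, by omega, by congr 1 <;> omega⟩
    · exact Or.inr <| Or.inr <| Or.inl ⟨j - (m + 1), by omega, by omega, by congr 1 <;> omega⟩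
    · exact Or.inr <| Or.inr <| Or.inr <| Or.inl (by rw [h.1, h.2])
    · exact Or.inr <| Or.inr <| Or.inr <| Or.inr <| Or.inl ⟨i, h.1, h.2.1, by rw [h.2.2]⟩
    · exact Or.inr <| Or.inr <| Or.inr <| Or.inr <| Or.inr <| Or.inl
        ⟨(i - (m + p)) / 2, by omega, by omega, by congr 1 <;> omega⟩
    · exact Or.inr <| Or.inr <| Or.inr <| Or.inr <| Or.inr <| Or.inr <| Or.inl
        (by rw [h.1, h.2])
    · exact Or.inr <| Or.inr <| Or.inr <| Or.inr <| Or.inr <| Or.inr <| Or.inr <| Or.inl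
        ⟨i / 2, by omega, by omega, by congr 1 <;> omega⟩
    · exact Or.inr <| Or.inr <| Or.inr <| Or.inr <| Or.inr <| Or.inr <| Or.inr <| Or.inr
        ⟨(i - (m + p)) / 2, by omega, by omega, by congr 1 <;> omega⟩
  · have inversion {i j : ℕ} (hi : 1 ≤ i) (hij : i < j) (hj : j ≤ 2 * m + p + 2) h :
        ∃ i' j', 1 ≤ i' ∧ i' < j' ∧ j' ≤ 2 * m + p + 2 ∧
          weylSInvValue m p j' < weylSInvValue m p i' ∧ rt i j = rt i' j' :=
      ⟨i, j, hi, hij, hj, (weylSInvValue_inversion_iff hm2 hme hi hij hj).2 h, rfl⟩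
    rintro (rfl | ⟨t, h₁, h₂, rfl⟩ | ⟨q, h₁, h₂, rfl⟩ | rfl | ⟨i, h₁, h₂, rfl⟩ |
      ⟨t, h₁, h₂, rfl⟩ | rfl | ⟨t, h₁, h₂, rfl⟩ | ⟨t, h₁, h₂, rfl⟩) <;>
    refine inversion (by omega) (by omega) (by omega) ?_
    · left
      omega
    · right; left
      omega
    · right; right; left
      omega
    · right; right; right; left
      omega
    · right; right; right; right; left
      omega
    · right; right; right; right; right; left
      omega
    · right; right; right; right; right; right; left
      omega
    · right; right; right; right; right; right; right; left
      omega
    · right; right; right; right; right; right; right; right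
      omega
end DPW
end
end

section
/- Let s be as in the context (any of the four cases). Let 2 ≤ f ≤ D+1, let η, η₁ ∈ Δ̄_K^f and η₂ ∈ Δ̄_K^f ∪ Δ̄_K^{f+1} ∪ ⋯ ∪ Δ̄_K^{D+1} with η = η₁ + η₂. If η₃ ∈ (Δ̄_K)₊ satisfies η + η₃ ∈ Δ, then either η + η₃ ∉ Δ̄_K^f or d(η₃) < f. -/
/- Common framework: type A_l root system realized in ℝ^{ℕ} (coordinates 1,…,l+1 used),
   the Weyl group as permutations of ℕ acting by permuting coordinates, and the
   Weyl group element s = s₁s₂ of Proposition 4.2 (all four parity cases). -/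

noncomputable section

namespace DPW

/-- The position in `1, …, l + 1` of the `u`-th point not fixed by `s`. -/
def pos (m p u : ℕ) : ℕ := if u ≤ m + 1 then u else u + p

/-- The action of `s⁻¹` on the points not fixed by `s`, numbered `1, …, n`. -/
def tau (m n u : ℕ) : ℕ :=
  if (u + m) % 2 = 0 then if u + 2 ≤ n then u + 2 else if u = n then n - 1 else n
  else if 3 ≤ u then u - 2 else if u = 2 then 1 else 2

/-- `s⁻¹` sends `i` to `j`, with `s` presented by its fixed block and by `tau`. -/
def Step (m p n i j : ℕ) : Prop :=
  (m + 2 ≤ i ∧ i ≤ m + p + 1 ∧ j = i) ∨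
    ∃ u, 1 ≤ u ∧ u ≤ n ∧ i = pos m p u ∧ j = pos m p (tau m n u)

/-- The block of points fixed by `s`. -/
def Fixd (m p i : ℕ) : Prop := m + 2 ≤ i ∧ i ≤ m + p + 1

theorem pos_lt_pos {m p u v : ℕ} : pos m p u < pos m p v ↔ u < v := by
  unfold pos; split_ifs <;> omega

theorem tau_spec (m n u : ℕ) (h1 : 1 ≤ u) (hu : u ≤ n) (hn : 4 ≤ n) :
    (u + m) % 2 = 0 ∧ (tau m n u = u + 2 ∧ u + 2 ≤ n ∨ u = n ∧ tau m n u + 1 = n ∨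
      u + 1 = n ∧ tau m n u = n) ∨
    (u + m) % 2 = 1 ∧ (tau m n u + 2 = u ∧ 3 ≤ u ∨ u = 2 ∧ tau m n u = 1 ∨
      u = 1 ∧ tau m n u = 2) := by
  unfold tau; split_ifs <;> omega

theorem pos_lt_fixd {m p u i : ℕ} (h₁ : m + 2 ≤ i) (h₂ : i ≤ m + p + 1) :
    pos m p u < i ↔ u ≤ m + 1 := by
  unfold pos; split_ifs <;> omega

theorem fixd_lt_pos {m p u i : ℕ} (h₁ : m + 2 ≤ i) (h₂ : i ≤ m + p + 1) :
    i < pos m p u ↔ m + 2 ≤ u := by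
  unfold pos; split_ifs <;> omega

theorem pos_ne_fixd {m p u i : ℕ} (hi : Fixd m p i) : i ≠ pos m p u := by
  unfold Fixd at hi; unfold pos; split_ifs <;> omega

theorem pos_inj {m p u v : ℕ} (h : pos m p u = pos m p v) : u = v := by
  have h1 := pos_lt_pos (m := m) (p := p) (u := u) (v := v)
  have h2 := pos_lt_pos (m := m) (p := p) (u := v) (v := u)
  omega

theorem eq_of_step_fixd {m p n i j : ℕ} (h : Step m p n i j) (hj : Fixd m p j) : i = j := by
  rcases h with ⟨-, -, h⟩ | ⟨u, -, -, -, h⟩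
  · exact h.symm
  · exact absurd h (pos_ne_fixd hj)

theorem step_pos {m p n i v : ℕ} (h : Step m p n i (pos m p v)) :
    ∃ u, 1 ≤ u ∧ u ≤ n ∧ i = pos m p u ∧ v = tau m n u := by
  rcases h with ⟨h1, h2, h⟩ | ⟨u, hu1, hu2, h, h'⟩
  · exact absurd h.symm (pos_ne_fixd ⟨h1, h2⟩)
  · exact ⟨u, hu1, hu2, h, pos_inj h'⟩

/-- If `x < a < b < c` and `a`, `b`, `c` were in this order one step earlier, then the next
step cannot move `c` below both `a` and `x`. -/
theorem no_left_extension {m p n x a b c x' a' b' c' a₀ b₀ : ℕ} (hm : 2 ≤ m)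
    (hn : n = 2 * m + 2 ∨ n = 2 * m + 3)
    (hx : Step m p n x x') (ha : Step m p n a a') (hb : Step m p n b b') (hc : Step m p n c c')
    (ha₀ : Step m p n a₀ a) (hb₀ : Step m p n b₀ b)
    (hab : ¬(Fixd m p a ∧ Fixd m p b)) (hbc : ¬(Fixd m p b ∧ Fixd m p c))
    (hac : ¬(Fixd m p a ∧ Fixd m p c)) (hxa : ¬(Fixd m p x ∧ Fixd m p a))
    (lxa : x < a) (lab : a < b) (lbc : b < c) (l₀ : a₀ < b₀) (fac : c' < a') (fxc : c' < x') :
    False := by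
  have spec := fun u h1 h2 => tau_spec m n u h1 h2 (by omega)
  rcases hc with ⟨hc1, hc2, rfl⟩ | ⟨w, hw1, hw2, rfl, rfl⟩ <;>
  rcases hx with ⟨hx1, hx2, rfl⟩ | ⟨u, hu1, hu2, rfl, rfl⟩ <;>
  rcases ha with ⟨ha1, ha2, rfl⟩ | ⟨v, hv1, hv2, rfl, rfl⟩ <;>
  rcases hb with ⟨hb1, hb2, rfl⟩ | ⟨z, hz1, hz2, rfl, rfl⟩ <;>
  try simp only [pos_lt_pos, pos_lt_fixd, fixd_lt_pos, *] at lxa lab lbc fac fxc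
  all_goals unfold Fixd at *
  all_goals try omega
  all_goals try have := spec u hu1 hu2
  all_goals try have := spec v hv1 hv2
  all_goals try have := spec w hw1 hw2
  all_goals try omega
  obtain ⟨z₀, hz₀, hz₀', rfl, rfl⟩ := step_pos hb₀
  obtain rfl := eq_of_step_fixd ha₀ ⟨ha1, ha2⟩
  rw [fixd_lt_pos ha1 ha2] at l₀
  have := spec z₀ hz₀ hz₀'
  omega

/-- If `a < b < c < x` and `a`, `b`, `c` were in this order one step earlier, then the next
step cannot move `a` above both `c` and `x`. -/
theorem no_right_extension {m p n x a b c x' a' b' c' b₀ c₀ : ℕ} (hm : 2 ≤ m)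
    (hn : n = 2 * m + 2 ∨ n = 2 * m + 3)
    (hx : Step m p n x x') (ha : Step m p n a a') (hb : Step m p n b b') (hc : Step m p n c c')
    (hb₀ : Step m p n b₀ b) (hc₀ : Step m p n c₀ c)
    (hab : ¬(Fixd m p a ∧ Fixd m p b)) (hbc : ¬(Fixd m p b ∧ Fixd m p c))
    (hac : ¬(Fixd m p a ∧ Fixd m p c)) (hcx : ¬(Fixd m p c ∧ Fixd m p x))
    (lab : a < b) (lbc : b < c) (lcx : c < x) (l₀ : b₀ < c₀) (fac : c' < a') (fax : x' < a') :
    False := by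
  have spec := fun u h1 h2 => tau_spec m n u h1 h2 (by omega)
  rcases hc with ⟨hc1, hc2, rfl⟩ | ⟨w, hw1, hw2, rfl, rfl⟩ <;>
  rcases hx with ⟨hx1, hx2, rfl⟩ | ⟨u, hu1, hu2, rfl, rfl⟩ <;>
  rcases ha with ⟨ha1, ha2, rfl⟩ | ⟨v, hv1, hv2, rfl, rfl⟩ <;>
  rcases hb with ⟨hb1, hb2, rfl⟩ | ⟨z, hz1, hz2, rfl, rfl⟩ <;>
  try simp only [pos_lt_pos, pos_lt_fixd, fixd_lt_pos, *] at lab lbc lcx fac fax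
  all_goals unfold Fixd at *
  all_goals try omega
  all_goals try have := spec u hu1 hu2
  all_goals try have := spec v hv1 hv2
  all_goals try have := spec w hw1 hw2
  all_goals try omega
  obtain ⟨z₀, hz₀, hz₀', rfl, rfl⟩ := step_pos hb₀
  obtain rfl := eq_of_step_fixd hc₀ ⟨hc1, hc2⟩
  rw [pos_lt_fixd hc1 hc2] at l₀
  have := spec z₀ hz₀ hz₀'
  omega

/-- The permutation `swapProd (List.range' a k 2)` as a function. -/
def block (a k i : ℕ) : ℕ :=
  if a ≤ i ∧ i < a + 2 * k then (if (i - a) % 2 = 0 then i + 1 else i - 1) else i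

theorem swapProd_apply (a k i : ℕ) : swapProd (List.range' a k 2) i = block a k i := by
  unfold block
  induction k generalizing a with
  | zero => simp [swapProd]
  | succ k ih =>
    have h : swapProd (List.range' a (k + 1) 2) =
        Equiv.swap a (a + 1) * swapProd (List.range' (a + 2) k 2) := by
      simp [swapProd, List.range'_succ]
    rw [h, Equiv.Perm.mul_apply, ih, Equiv.swap_apply_def]
    split_ifs <;> omega

theorem swapProd_fixd {m p a k i : ℕ} (hi : Fixd m p i) (h : a + 2 * k ≤ m + 2 ∨ m + p + 2 ≤ a) :
    swapProd (List.range' a k 2) i = i := by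
  unfold Fixd at hi
  rw [swapProd_apply, block, if_neg (by omega)]

theorem swapProd_pos_left {m p a k u : ℕ} (h : a + 2 * k ≤ m + 2) :
    swapProd (List.range' a k 2) (pos m p u) = pos m p (block a k u) := by
  rw [swapProd_apply]; unfold block pos; split_ifs <;> omega

theorem swapProd_pos_right {m p a b k u : ℕ} (hb : b = a + p) (h : m + 2 ≤ a) :
    swapProd (List.range' b k 2) (pos m p u) = pos m p (block a k u) := by
  rw [swapProd_apply]; unfold block pos; split_ifs <;> omega

theorem swap_pos (m p u : ℕ) :
    Equiv.swap (m + 1) (m + p + 2) (pos m p u) = pos m p (block (m + 1) 1 u) := by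
  rw [Equiv.swap_apply_def]; unfold block pos; split_ifs <;> omega

/-- The factor `s₂` on the points not fixed by `s`. -/
def sigma₂ (m n u : ℕ) : ℕ :=
  if (u + m) % 2 = 1 then if u + 1 ≤ n then u + 1 else u
  else if 2 ≤ u then u - 1 else u

/-- The factor `s₁` on the points not fixed by `s`. -/
def sigma₁ (m n u : ℕ) : ℕ :=
  if (u + m) % 2 = 0 then if u + 1 ≤ n then u + 1 else u
  else if 2 ≤ u then u - 1 else u

theorem sigma₂_tau {m n u : ℕ} (h1 : 1 ≤ u) (hu : u ≤ n) (hn : 4 ≤ n) :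
    sigma₂ m n (tau m n u) = sigma₁ m n u := by
  have := tau_spec m n u h1 hu hn
  unfold sigma₁ sigma₂; split_ifs <;> omega

theorem sigma₁_sigma₁ {m n u : ℕ} (h1 : 1 ≤ u) (hu : u ≤ n) :
    sigma₁ m n (sigma₁ m n u) = u := by
  unfold sigma₁; split_ifs <;> omega

theorem tau_mem {m n u : ℕ} (h1 : 1 ≤ u) (hu : u ≤ n) (hn : 4 ≤ n) :
    1 ≤ tau m n u ∧ tau m n u ≤ n := by
  unfold tau; split_ifs <;> omega

theorem sigma₁_eq_block {m n a k k' u : ℕ} (h1 : 1 ≤ u) (hu : u ≤ n) (ha : 1 ≤ a ∧ a ≤ 2)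
    (hk : a + 2 * k = m + 2) (hk' : m + 1 + 2 * k' ≤ n ∧ n ≤ m + 2 + 2 * k') :
    block a k (block (m + 2) k' u) = sigma₁ m n u := by
  unfold block sigma₁; split_ifs <;> omega

theorem sigma₂_eq_block {m n a k k' u : ℕ} (h1 : 1 ≤ u) (hu : u ≤ n) (ha : 1 ≤ a ∧ a ≤ 2)
    (hk : a + 2 * k = m + 1) (hk' : m + 2 + 2 * k' ≤ n ∧ n ≤ m + 3 + 2 * k') :
    block a k (block (m + 1) 1 (block (m + 3) k' u)) = sigma₂ m n u := by
  have h : block (m + 1) 1 (block (m + 3) k' u) = block (m + 1) (k' + 1) u := by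
    unfold block; split_ifs <;> omega
  rw [h]
  unfold block sigma₂; split_ifs <;> omega

theorem exists_weylS_eq {l l' m p : ℕ} (h5 : 5 ≤ l') (hm : m = (l' - 1) / 2) (hp : p = l - l') :
    ∃ a k₁ k₂ b k₃ k₄, (1 ≤ a ∧ a ≤ 2) ∧ a + 2 * k₁ = m + 2 ∧
      (m + 1 + 2 * k₂ ≤ l' + 1 ∧ l' + 1 ≤ m + 2 + 2 * k₂) ∧
      (1 ≤ b ∧ b ≤ 2) ∧ b + 2 * k₃ = m + 1 ∧
      (m + 2 + 2 * k₄ ≤ l' + 1 ∧ l' + 1 ≤ m + 3 + 2 * k₄) ∧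
      weylS l l' =
        (swapProd (List.range' a k₁ 2) * swapProd (List.range' (m + p + 2) k₂ 2)) *
          (swapProd (List.range' b k₃ 2) * Equiv.swap (m + 1) (m + p + 2) *
            swapProd (List.range' (m + p + 3) k₄ 2)) := by
  unfold weylS
  simp only [← hm, ← hp]
  split_ifs with h₁ h₂ h₂ <;> refine ⟨_, _, _, _, _, _, ?_, ?_, ?_, ?_, ?_, ?_, rfl⟩ <;> omega

theorem weylS_inv_step {l l' m p i : ℕ} (h5 : 5 ≤ l') (hll : l' ≤ l)
    (hm : m = (l' - 1) / 2) (hp : p = l - l') (h1 : 1 ≤ i) (hi : i ≤ l + 1) :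
    Step m p (l' + 1) i ((weylS l l')⁻¹ i) := by
  obtain ⟨a, k₁, k₂, b, k₃, k₄, ha, hk₁, hk₂, hb, hk₃, hk₄, hs⟩ := exists_weylS_eq h5 hm hp
  by_cases hf : Fixd m p i
  · refine Or.inl ⟨hf.1, hf.2, ?_⟩
    rw [Equiv.Perm.inv_eq_iff_eq, hs]
    simp only [Equiv.Perm.mul_apply]
    rw [swapProd_fixd hf (by omega), Equiv.swap_apply_of_ne_of_ne (by unfold Fixd at hf; omega)
      (by unfold Fixd at hf; omega), swapProd_fixd hf (by omega), swapProd_fixd hf (by omega),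
      swapProd_fixd hf (by omega)]
  · obtain ⟨u, hu1, hu2, rfl⟩ : ∃ u, 1 ≤ u ∧ u ≤ l' + 1 ∧ i = pos m p u := by
      refine ⟨if i ≤ m + 1 then i else i - p, ?_⟩
      unfold Fixd at hf
      unfold pos
      split_ifs <;> omega
    refine Or.inr ⟨u, hu1, hu2, rfl, ?_⟩
    obtain ⟨ht1, ht2⟩ := tau_mem (m := m) hu1 hu2 (by omega)
    rw [Equiv.Perm.inv_eq_iff_eq, hs]
    simp only [Equiv.Perm.mul_apply]
    rw [swapProd_pos_right (a := m + 3) (by omega) (by omega), swap_pos,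
      swapProd_pos_left (by omega), sigma₂_eq_block ht1 ht2 hb hk₃ hk₄,
      sigma₂_tau hu1 hu2 (by omega),
      swapProd_pos_right (a := m + 2) (by omega) le_rfl, swapProd_pos_left (by omega),
      sigma₁_eq_block _ _ ha hk₁ hk₂, sigma₁_sigma₁ hu1 hu2]
    all_goals unfold sigma₁; split_ifs <;> omega

theorem evec_apply (i j : ℕ) : evec i j = if j = i then 1 else 0 := rfl

theorem rt_inj {i j i' j' : ℕ} (hij : i ≠ j) (h : rt i j = rt i' j') : i = i' ∧ j = j' := by
  have hi := congrFun h i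
  have hj := congrFun h j
  simp only [rt, Pi.sub_apply, evec_apply, if_pos, if_neg hij, if_neg hij.symm] at hi hj
  grind

theorem rt_eq_add {i j a b c d : ℕ} (hij : i ≠ j) (hab : a ≠ b) (hcd : c ≠ d)
    (h : rt i j = rt a b + rt c d) : (i = a ∧ b = c ∧ j = d) ∨ (i = c ∧ d = a ∧ j = b) := by
  have key : ∀ x, (if x = i then 1 else 0) - (if x = j then 1 else 0) =
      ((if x = a then 1 else 0) - (if x = b then 1 else 0) +
        ((if x = c then 1 else 0) - (if x = d then 1 else 0)) : ℝ) := fun x => congrFun h x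
  have hi := key i
  have hj := key j
  have ha := key a
  have hc := key c
  grind

theorem rt_mem_DeltaPos {l i j : ℕ} : rt i j ∈ DeltaPos l ↔ 1 ≤ i ∧ i < j ∧ j ≤ l + 1 := by
  constructor
  · rintro ⟨a, b, ha, hab, hb, h⟩
    obtain ⟨rfl, rfl⟩ := rt_inj hab.ne h.symm
    exact ⟨ha, hab, hb⟩
  · rintro ⟨ha, hab, hb⟩
    exact ⟨i, j, ha, hab, hb, rfl⟩

theorem rt_mem_DeltaKpos {l i j : ℕ} {s : Equiv.Perm ℕ} :
    rt i j ∈ DeltaKpos l s ↔ (1 ≤ i ∧ i < j ∧ j ≤ l + 1) ∧ ¬(s⁻¹ i = i ∧ s⁻¹ j = j) := by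
  unfold DeltaKpos
  rw [Set.mem_sep_iff, rt_mem_DeltaPos, pact_rt]
  refine and_congr_right fun h => not_congr ⟨fun h' => ?_, fun h' => ?_⟩
  · obtain ⟨h₁, h₂⟩ := rt_inj h.2.1.ne h'.symm
    exact ⟨Equiv.Perm.inv_eq_iff_eq.2 h₁, Equiv.Perm.inv_eq_iff_eq.2 h₂⟩
  · rw [← Equiv.Perm.inv_eq_iff_eq.1 h'.1, ← Equiv.Perm.inv_eq_iff_eq.1 h'.2]

theorem exists_rt_of_mem_DeltaKpos {l : ℕ} {s : Equiv.Perm ℕ} {v : V} (h : v ∈ DeltaKpos l s) :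
    ∃ i j, i < j ∧ v = rt i j := by
  obtain ⟨⟨i, j, -, hij, -, rfl⟩, -⟩ := h
  exact ⟨i, j, hij, rfl⟩

theorem pact_mem_of_mem_DeltaKk {l k f : ℕ} {s : Equiv.Perm ℕ} {v : V} (h : v ∈ DeltaKk l s f)
    (hk : k < f) : pact (s⁻¹ ^ k) v ∈ DeltaKpos l s := by
  rcases Nat.eq_zero_or_pos k with rfl | hk'
  · rw [pow_zero]
    exact h.1
  · exact h.2.1 k hk' (by omega)

theorem rt_mem_of_mem_DeltaKk {l k f i j : ℕ} {s : Equiv.Perm ℕ} (h : rt i j ∈ DeltaKk l s f)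
    (hk : k < f) : rt ((s⁻¹ ^ k) i) ((s⁻¹ ^ k) j) ∈ DeltaKpos l s := by
  rw [← pact_rt]; exact pact_mem_of_mem_DeltaKk h hk

theorem pow_lt_pow_of_mem_DeltaKk {l f i j : ℕ} {s : Equiv.Perm ℕ} (h : rt i j ∈ DeltaKk l s f) :
    (s⁻¹ ^ f) j < (s⁻¹ ^ f) i := by
  have h' : -pact (s⁻¹ ^ f) (rt i j) ∈ DeltaKpos l s := h.2.2
  rw [pact_rt, neg_rt, rt_mem_DeltaKpos] at h'
  exact h'.1.2.1

/-- A root of level at least `f` is still positive after `k < f` applications of `s⁻¹`. -/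
theorem rt_mem_of_le_dd {l k f i j : ℕ} {s : Equiv.Perm ℕ} (h : rt i j ∈ DeltaKpos l s)
    (hf : f ≤ dd l s (rt i j)) (hk : k < f)
    (hi : 1 ≤ (s⁻¹ ^ k) i ∧ (s⁻¹ ^ k) i ≤ l + 1) (hj : 1 ≤ (s⁻¹ ^ k) j ∧ (s⁻¹ ^ k) j ≤ l + 1) :
    rt ((s⁻¹ ^ k) i) ((s⁻¹ ^ k) j) ∈ DeltaKpos l s := by
  obtain ⟨h1, h2⟩ := rt_mem_DeltaKpos.1 h
  have hlt : (s⁻¹ ^ k) i < (s⁻¹ ^ k) j := by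
    rcases Nat.eq_zero_or_pos k with rfl | hk'
    · simpa using h1.2.1
    · by_contra hle
      have hne : (s⁻¹ ^ k) i ≠ (s⁻¹ ^ k) j := (s⁻¹ ^ k).injective.ne h1.2.1.ne
      have hmem : 1 ≤ k ∧ pact (s⁻¹ ^ k) (rt i j) ∈ DeltaNeg l := by
        refine ⟨hk', ?_⟩
        change -pact (s⁻¹ ^ k) (rt i j) ∈ DeltaPos l
        rw [pact_rt, neg_rt, rt_mem_DeltaPos]
        omega
      have : dd l s (rt i j) ≤ k := Nat.sInf_le hmem
      omega
  have hfix : ∀ x, s⁻¹ ((s⁻¹ ^ k) x) = (s⁻¹ ^ k) x → s⁻¹ x = x := fun x hx =>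
    (s⁻¹ ^ k).injective <| by
      rw [← hx, ← Equiv.Perm.mul_apply, ← Equiv.Perm.mul_apply, ← pow_succ, ← pow_succ']
  exact rt_mem_DeltaKpos.2 ⟨⟨hi.1, hlt, hj.2⟩, fun h => h2 ⟨hfix i h.1, hfix j h.2⟩⟩

theorem not_fixd_of_mem_DeltaKpos {l l' m p i j : ℕ} (h5 : 5 ≤ l') (hll : l' ≤ l)
    (hm : m = (l' - 1) / 2) (hp : p = l - l') (h : rt i j ∈ DeltaKpos l (weylS l l')) :
    ¬(Fixd m p i ∧ Fixd m p j) := by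
  rintro ⟨hi, hj⟩
  obtain ⟨⟨h1, h2, h3⟩, h4⟩ := rt_mem_DeltaKpos.1 h
  have fix : ∀ x, 1 ≤ x → x ≤ l + 1 → Fixd m p x → (weylS l l')⁻¹ x = x := by
    intro x hx1 hx2 hx
    rcases weylS_inv_step h5 hll hm hp hx1 hx2 with ⟨-, -, h⟩ | ⟨u, -, -, h, -⟩
    · exact h
    · exact absurd h (pos_ne_fixd hx)
  exact h4 ⟨fix i h1 (by omega) hi, fix j (by omega) h3 hj⟩

/-- for f ≥ 2, η, η₁ ∈ Δ̄_K^f, η₂ ∈ ⋃_{i ≥ f} Δ̄_K^i with η = η₁ + η₂: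
if η₃ ∈ (Δ̄_K)₊ and η + η₃ ∈ Δ, then either η + η₃ ∉ Δ̄_K^f or d(η₃) < f. -/
theorem stmt15 (l l' m p : ℕ) (h5 : 5 ≤ l') (hll : l' ≤ l)
    (hm : m = (l' - 1) / 2) (hp : p = l - l') :
    let s := weylS l l'
    ∀ f, 2 ≤ f → ∀ η ∈ DeltaKk l s f, ∀ η₁ ∈ DeltaKk l s f,
      ∀ η₂, (∃ i, f ≤ i ∧ η₂ ∈ DeltaKk l s i) → η = η₁ + η₂ →
        ∀ η₃ ∈ DeltaKpos l s, η + η₃ ∈ Delta l →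
          η + η₃ ∉ DeltaKk l s f ∨ dd l s η₃ < f := by
  intro s f hf η hη η₁ hη₁ η₂ ⟨f₂, hf₂, hη₂⟩ hsum η₃ hη₃ _
  have hn : l' + 1 = 2 * m + 2 ∨ l' + 1 = 2 * m + 3 := by omega
  have hm2 : 2 ≤ m := by omega
  have step : ∀ k x, 1 ≤ (s⁻¹ ^ k) x ∧ (s⁻¹ ^ k) x ≤ l + 1 →
      Step m p (l' + 1) ((s⁻¹ ^ k) x) ((s⁻¹ ^ (k + 1)) x) := fun k x h => by
    rw [pow_succ', Equiv.Perm.mul_apply]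
    exact weylS_inv_step h5 hll hm hp h.1 h.2
  have nf : ∀ i j, rt i j ∈ DeltaKpos l s → ¬(Fixd m p i ∧ Fixd m p j) :=
    fun i j => not_fixd_of_mem_DeltaKpos h5 hll hm hp
  clear_value s
  clear hm hp
  by_contra! hcon
  obtain ⟨hη', hd⟩ := hcon
  obtain ⟨a, c, hac, rfl⟩ := exists_rt_of_mem_DeltaKpos hη.1
  obtain ⟨a₃, c₃, hac₃, rfl⟩ := exists_rt_of_mem_DeltaKpos hη₃
  obtain ⟨b, hab, hbc⟩ : ∃ b,
      (∀ k < f, rt ((s⁻¹ ^ k) a) ((s⁻¹ ^ k) b) ∈ DeltaKpos l s) ∧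
      (∀ k < f, rt ((s⁻¹ ^ k) b) ((s⁻¹ ^ k) c) ∈ DeltaKpos l s) := by
    obtain ⟨a₁, c₁, hac₁, rfl⟩ := exists_rt_of_mem_DeltaKpos hη₁.1
    obtain ⟨a₂, c₂, hac₂, rfl⟩ := exists_rt_of_mem_DeltaKpos hη₂.1
    have h₁ := fun k (hk : k < f) => rt_mem_of_mem_DeltaKk hη₁ hk
    have h₂ := fun k (hk : k < f) => rt_mem_of_mem_DeltaKk hη₂ (hk.trans_le hf₂)
    rcases rt_eq_add hac.ne hac₁.ne hac₂.ne hsum with ⟨rfl, rfl, rfl⟩ | ⟨rfl, rfl, rfl⟩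
    · exact ⟨_, h₁, h₂⟩
    · exact ⟨_, h₂, h₁⟩
  obtain ⟨g, rfl⟩ : ∃ g, f = g + 2 := ⟨f - 2, by omega⟩
  have hg : g < g + 2 := by omega
  have hg1 : g + 1 < g + 2 := by omega
  have lt {i j : ℕ} (h : rt i j ∈ DeltaKpos l s) : i < j := (rt_mem_DeltaKpos.1 h).1.2.1
  have fst {i j : ℕ} (h : rt i j ∈ DeltaKpos l s) : 1 ≤ i ∧ i ≤ l + 1 :=
    ⟨(rt_mem_DeltaKpos.1 h).1.1, (lt h).le.trans (rt_mem_DeltaKpos.1 h).1.2.2⟩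
  have snd {i j : ℕ} (h : rt i j ∈ DeltaKpos l s) : 1 ≤ j ∧ j ≤ l + 1 :=
    ⟨(fst h).1.trans (lt h).le, (rt_mem_DeltaKpos.1 h).1.2.2⟩
  have ab₀ := hab g hg
  have bc₀ := hbc g hg
  have ab := hab (g + 1) hg1
  have bc := hbc (g + 1) hg1
  have ac := rt_mem_of_mem_DeltaKk hη hg1
  have flip := pow_lt_pow_of_mem_DeltaKk hη
  obtain ⟨i, j, hij, hrt⟩ := exists_rt_of_mem_DeltaKpos hη'.1
  rw [hrt] at hη'
  have flip' := pow_lt_pow_of_mem_DeltaKk hη'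
  have ij := rt_mem_of_mem_DeltaKk hη' hg1
  rcases rt_eq_add hij.ne hac.ne hac₃.ne hrt.symm with ⟨rfl, rfl, rfl⟩ | ⟨rfl, rfl, rfl⟩
  · have cx := rt_mem_of_le_dd hη₃ hd hg1 (snd bc) (snd ij)
    exact no_right_extension hm2 hn (step (g + 1) _ (snd cx)) (step (g + 1) _ (fst ab))
      (step (g + 1) _ (snd ab)) (step (g + 1) _ (snd bc)) (step g _ (snd ab₀))
      (step g _ (snd bc₀)) (nf _ _ ab) (nf _ _ bc) (nf _ _ ac) (nf _ _ cx)
      (lt ab) (lt bc) (lt cx) (lt bc₀) flip flip'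
  · have xa := rt_mem_of_le_dd hη₃ hd hg1 (fst ij) (fst ab)
    exact no_left_extension hm2 hn (step (g + 1) _ (fst xa)) (step (g + 1) _ (fst ab))
      (step (g + 1) _ (snd ab)) (step (g + 1) _ (snd bc)) (step g _ (fst ab₀))
      (step g _ (snd ab₀)) (nf _ _ ab) (nf _ _ bc) (nf _ _ ac) (nf _ _ xa)
      (lt xa) (lt ab) (lt bc) (lt ab₀) flip flip'
end DPW
end
end
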